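/- arXiv:1205.1927 — 8 statements merged into one kernel-verified Lean document; each statement's English description precedes it below -/
import Mathlib

section
/- Let P be a predicate on finite groups such that the class of finite groups failing P is closed under homomorphic images (i.e., for every finite group G and every normal subgroup N of G, if G does not satisfy P then the quotient G/N does not satisfy P). If P is core-free interval enforceable by a finite lattice L, then P is interval enforceable by the same lattice L: every finite group G possessing a subgroup H with the interval ⟦H,G⟧ order-isomorphic to L satisfies P. -/
/-- The correspondence theorem for intervals: a surjective homomorphism whose kernel lies in `H`
identifies the subgroups above `H` with those above its image. -/
def Subgroup.mapIccOrderIso {G G' : Type*} [Group G] [Group G'] {f : G →* G'}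
    (hf : Function.Surjective f) {H : Subgroup G} (hker : f.ker ≤ H) :
    Set.Icc H ⊤ ≃o Set.Icc (H.map f) ⊤ where
  toFun K := ⟨K.1.map f, Subgroup.map_mono K.2.1, le_top⟩
  invFun K := ⟨K.1.comap f, Subgroup.map_le_iff_le_comap.mp K.2.1, le_top⟩
  left_inv K := Subtype.ext (Subgroup.comap_map_eq_self (hker.trans K.2.1))
  right_inv K := Subtype.ext (Subgroup.map_comap_eq_self_of_surjective hf K.1)
  map_rel_iff' {K K'} := by
    change K.1.map f ≤ K'.1.map f ↔ K.1 ≤ K'.1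
    rw [Subgroup.map_le_iff_le_comap, Subgroup.comap_map_eq_self (hker.trans K'.2.1)]

/-- The image of a subgroup in the quotient by its normal core is core-free. -/
theorem Subgroup.normalCore_map_mk'_normalCore {G : Type*} [Group G] (H : Subgroup G) :
    (H.map (QuotientGroup.mk' H.normalCore)).normalCore = ⊥ := by
  set π := QuotientGroup.mk' H.normalCore
  have hker : π.ker = H.normalCore := QuotientGroup.ker_mk' _
  have hle : (H.map π).normalCore.comap π ≤ π.ker := by
    rw [hker, Subgroup.normal_le_normalCore]
    refine (Subgroup.comap_mono (Subgroup.normalCore_le _)).trans_eq ?_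
    exact Subgroup.comap_map_eq_self (hker.trans_le H.normalCore_le)
  rw [← Subgroup.map_comap_eq_self_of_surjective (QuotientGroup.mk'_surjective H.normalCore)
    (H.map π).normalCore]
  exact (Subgroup.map_eq_bot_iff _).mpr hle

/-- If the class of finite groups failing `P` is closed under
homomorphic images (quotients), and `P` is core-free interval enforceable by a
finite lattice `L`, then `P` is interval enforceable by `L`. -/
theorem stmt_0
    (P : ∀ (G : Type) [Group G] [Finite G], Prop)
    (hH : ∀ (G : Type) [Group G] [Finite G] (N : Subgroup G) [N.Normal],
        ¬ P G → ¬ P (G ⧸ N))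
    (L : Type) [Lattice L] [Finite L]
    (hcfIE : ∀ (G : Type) [Group G] [Finite G] (H : Subgroup G),
        H.normalCore = ⊥ → Nonempty (L ≃o Set.Icc H (⊤ : Subgroup G)) → P G) :
    ∀ (G : Type) [Group G] [Finite G] (H : Subgroup G),
      Nonempty (L ≃o Set.Icc H (⊤ : Subgroup G)) → P G := by
  intro G _ _ H ⟨e⟩
  by_contra hG
  refine hH G H.normalCore hG (hcfIE _ _ H.normalCore_map_mk'_normalCore ⟨e.trans ?_⟩)
  exact Subgroup.mapIccOrderIso (QuotientGroup.mk'_surjective _)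
    ((QuotientGroup.ker_mk' _).trans_le H.normalCore_le)
end

section
/- Let G and K be groups and let H be a subgroup of G. Then the interval ⟦H × K, G × K⟧ in the subgroup lattice of the direct product G × K (that is, Set.Icc (H.prod ⊤) ⊤ in Subgroup (G × K)) is order-isomorphic to the interval ⟦H, G⟧ in the subgroup lattice of G (that is, Set.Icc H ⊤ in Subgroup G). -/
namespace Subgroup

variable {G K : Type*} [Group G] [Group K]

theorem comap_inl_prod_top (M : Subgroup G) :
    (M.prod (⊤ : Subgroup K)).comap (MonoidHom.inl G K) = M := by
  ext g
  simp [mem_prod]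

theorem prod_top_comap_inl {H : Subgroup G} {L : Subgroup (G × K)}
    (hL : H.prod (⊤ : Subgroup K) ≤ L) :
    (L.comap (MonoidHom.inl G K)).prod ⊤ = L := by
  ext ⟨g, k⟩
  have hk : ((1 : G), k) ∈ L := hL (by simp [mem_prod, H.one_mem])
  have h : (g, (1 : K)) * (1, k) = (g, k) := by simp
  simp only [mem_prod, mem_comap, MonoidHom.inl_apply, mem_top, and_true]
  rw [← h, L.mul_mem_cancel_right hk]

/-- Intervals `⟦H × K, G × K⟧` and `⟦H, G⟧` correspond via `M ↦ M × K`. -/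
def IccProdTopOrderIso (H : Subgroup G) :
    Set.Icc (H.prod (⊤ : Subgroup K)) ⊤ ≃o Set.Icc H ⊤ where
  toFun L := ⟨L.1.comap (MonoidHom.inl G K), by
    have h := comap_mono (f := MonoidHom.inl G K) L.2.1
    rwa [comap_inl_prod_top] at h, le_top⟩
  invFun M := ⟨M.1.prod ⊤, prod_mono M.2.1 le_rfl, le_top⟩
  left_inv L := Subtype.ext (prod_top_comap_inl L.2.1)
  right_inv M := Subtype.ext (comap_inl_prod_top M.1)
  map_rel_iff' {L₁ L₂} := by
    refine ⟨fun h => ?_, fun h => comap_mono h⟩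
    have h' := prod_mono (Subtype.coe_le_coe.mpr h) (le_refl (⊤ : Subgroup K))
    rwa [Equiv.coe_fn_mk, prod_top_comap_inl L₁.2.1, prod_top_comap_inl L₂.2.1] at h'

end Subgroup

/-- The interval `⟦H × K, G × K⟧` in `Sub(G × K)` is
order-isomorphic to the interval `⟦H, G⟧` in `Sub(G)`. -/
theorem stmt_2 (G K : Type) [Group G] [Group K] (H : Subgroup G) :
    Nonempty ((Set.Icc (H.prod (⊤ : Subgroup K)) (⊤ : Subgroup (G × K))) ≃o
      (Set.Icc H (⊤ : Subgroup G))) :=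
  ⟨Subgroup.IccProdTopOrderIso H⟩
end

section
/- Assume that every finite lattice is group representable, i.e., for every finite nonempty lattice L there exist a finite group G and a subgroup H ≤ G such that L is order-isomorphic to the interval ⟦H,G⟧. Then for every n ≥ 2 and every family L₁, …, Lₙ of finite nonempty lattices such that at least two of the Lᵢ have more than two elements, there exist a finite group G and subgroups H₁, …, Hₙ of G such that for each i the lattice Lᵢ is order-isomorphic to ⟦Hᵢ,G⟧, and moreover every proper subgroup Y of G satisfying Hᵢ ≤ Y for some i is core-free in G (in particular each Hᵢ is core-free in G). -/
/-- The order obtained from `α` by keeping only the top element and the elements of a lower set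
`S`. -/
abbrev TopOrLower {α : Type*} [LE α] [OrderTop α] (S : LowerSet α) : Type _ :=
  {x : α // x = ⊤ ∨ x ∈ S}

open Classical in
/-- Adjoining a top element to a lower set of a lattice gives a lattice. -/
noncomputable instance TopOrLower.instLattice {α : Type*} [Lattice α] [OrderTop α]
    (S : LowerSet α) : Lattice (TopOrLower S) where
  sup x y := if h : x.1 ⊔ y.1 ∈ S then ⟨x.1 ⊔ y.1, Or.inr h⟩ else ⟨⊤, Or.inl rfl⟩
  le_sup_left x y := by
    rw [← Subtype.coe_le_coe]
    split_ifs
    · exact le_sup_left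
    · exact le_top
  le_sup_right x y := by
    rw [← Subtype.coe_le_coe]
    split_ifs
    · exact le_sup_right
    · exact le_top
  sup_le x y z hx hy := by
    have hxy : x.1 ⊔ y.1 ≤ z.1 := sup_le hx hy
    rw [← Subtype.coe_le_coe]
    split_ifs with h
    · exact hxy
    · rcases z.2 with hz | hz
      · exact hz.ge
      · exact absurd (S.lower hxy hz) h
  inf x y := ⟨x.1 ⊓ y.1, by
    rcases x.2 with hx | hx
    · simpa [hx] using y.2
    · exact Or.inr (S.lower inf_le_left hx)⟩
  inf_le_left x y := Subtype.coe_le_coe.1 inf_le_left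
  inf_le_right x y := Subtype.coe_le_coe.1 inf_le_right
  le_inf x y z hy hz := Subtype.coe_le_coe.1 (le_inf hy hz)

section Parachute

variable {ι : Type*} (L : ι → Type*) [∀ i, Lattice (L i)] [∀ i, BoundedOrder (L i)]

/-- The families supported on a single index, where they do not reach the top. -/
def chutes : LowerSet (∀ i, WithBot (L i)) where
  carrier := {f | ∃ i, f i ≠ ⊤ ∧ ∀ j, j ≠ i → f j = ⊥}
  lower' := by
    rintro f g hgf ⟨i, hi, hf⟩
    refine ⟨i, fun h => hi (top_le_iff.1 (h ▸ hgf i)), fun j hj => ?_⟩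
    exact le_bot_iff.1 (hf j hj ▸ hgf j)

/-- The parachute lattice: the lattices `L i` glued along their tops, above a new bottom
element. -/
abbrev Parachute : Type _ := TopOrLower (chutes L)

variable {L}

open Classical in
/-- The inclusion of the `i`-th lattice in the parachute. -/
noncomputable def Parachute.incl (i : ι) : L i ↪o Parachute L :=
  OrderEmbedding.ofMapLEIff
    (fun x => ⟨Function.update (if x = ⊤ then ⊤ else ⊥) i (x : WithBot (L i)), by
      by_cases hx : x = ⊤
      · left
        subst hx
        rw [if_pos rfl]
        exact Function.update_eq_self i ⊤
      · right
        refine ⟨i, ?_, fun j hj => ?_⟩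
        · simpa [← WithBot.coe_top] using hx
        · simp [hx, hj]⟩)
    (fun x y => by
      rw [← Subtype.coe_le_coe, update_le_update_iff]
      simp only [WithBot.coe_le_coe, and_iff_left_iff_imp]
      intro hxy j _
      by_cases hy : y = ⊤
      · simp [hy]
      · have hx : x ≠ ⊤ := fun h => hy (top_le_iff.1 (h ▸ hxy))
        simp [hx])

theorem Parachute.incl_val_self (i : ι) (x : L i) :
    (Parachute.incl i x).1 i = x := by
  simp [Parachute.incl]

theorem Parachute.incl_top (i : ι) : (Parachute.incl i (⊤ : L i)).1 = ⊤ := by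
  simp only [Parachute.incl, OrderEmbedding.coe_ofMapLEIff, if_pos]
  classical exact Function.update_eq_self i ⊤

theorem Parachute.incl_val_of_ne {i : ι} {x : L i} (hx : x ≠ ⊤) {j : ι} (hj : j ≠ i) :
    (Parachute.incl i x).1 j = ⊥ := by
  simp [Parachute.incl, hx, hj]

theorem Parachute.exists_incl_eq {p : Parachute L} {i : ι} (hp : p.1 i ≠ ⊥) :
    ∃ x, Parachute.incl i x = p := by
  rcases p.2 with h | ⟨k, hk, hf⟩
  · exact ⟨⊤, Subtype.ext ((Parachute.incl_top i).trans h.symm)⟩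
  · obtain rfl : i = k := by
      by_contra hik
      exact hp (hf i hik)
    obtain ⟨x, hx⟩ := WithBot.ne_bot_iff_exists.1 hp
    have hxt : x ≠ ⊤ := by
      rintro rfl
      exact hk hx.symm
    refine ⟨x, Subtype.ext (funext fun j => ?_)⟩
    by_cases hj : j = i
    · subst hj
      rw [Parachute.incl_val_self, hx]
    · rw [Parachute.incl_val_of_ne hxt hj, hf j hj]

theorem Parachute.val_ne_bot_of_incl_le {p : Parachute L} {i : ι} {x : L i}
    (h : Parachute.incl i x ≤ p) : p.1 i ≠ ⊥ := by
  intro hp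
  have := h i
  rw [hp, Parachute.incl_val_self] at this
  exact WithBot.coe_ne_bot (le_bot_iff.1 this)

theorem Parachute.eq_top_of_ne_bot {p : Parachute L} {i j : ι} (hij : i ≠ j)
    (hi : p.1 i ≠ ⊥) (hj : p.1 j ≠ ⊥) : p.1 = ⊤ := by
  rcases p.2 with h | ⟨k, -, hf⟩
  · exact h
  · by_cases hik : i = k
    · exact absurd (hf j fun h => hij (hik.trans h.symm)) hj
    · exact absurd (hf i hik) hi

end Parachute

/-- Every upper interval of a subgroup lattice is isomorphic to one over a core-free subgroup. -/
theorem Subgroup.exists_normalCore_eq_bot_orderIso {G : Type} [Group G] [Finite G]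
    (H : Subgroup G) :
    ∃ (G' : Type) (_ : Group G') (_ : Finite G') (H' : Subgroup G'),
      H'.normalCore = ⊥ ∧ Nonempty (Set.Icc H ⊤ ≃o Set.Icc H' ⊤) := by
  let π := QuotientGroup.mk' H.normalCore
  have hπ : Function.Surjective π := QuotientGroup.mk'_surjective _
  have hker : π.ker = H.normalCore := QuotientGroup.ker_mk' _
  have hcm : ∀ K, H ≤ K → (K.map π).comap π = K := fun K hK => by
    rw [Subgroup.comap_map_eq, hker]
    exact sup_eq_left.2 (H.normalCore_le.trans hK)
  have hmc : ∀ K, (Subgroup.comap π K).map π = K := Subgroup.map_comap_eq_self_of_surjective hπ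
  refine ⟨G ⧸ H.normalCore, inferInstance, inferInstance, H.map π, ?_, ⟨?_⟩⟩
  · have hle : (H.map π).normalCore.comap π ≤ H.normalCore := by
      rw [Subgroup.normal_le_normalCore]
      exact (Subgroup.comap_mono (Subgroup.normalCore_le _)).trans (hcm H le_rfl).le
    rw [← hmc (H.map π).normalCore, eq_bot_iff, Subgroup.map_le_iff_le_comap]
    exact hle.trans hker.ge
  · exact
      { toFun := fun K => ⟨K.1.map π, Subgroup.map_mono K.2.1, le_top⟩
        invFun := fun K => ⟨K.1.comap π, Subgroup.map_le_iff_le_comap.1 K.2.1, le_top⟩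
        left_inv := fun K => Subtype.ext (hcm K.1 K.2.1)
        right_inv := fun K => Subtype.ext (hmc K.1)
        map_rel_iff' := by
          intro A B
          change A.1.map π ≤ B.1.map π ↔ A.1 ≤ B.1
          rw [Subgroup.map_le_iff_le_comap, hcm B.1 B.2.1] }

/-- A consequence of the Dedekind law. -/
theorem Subgroup.le_of_inf_le_of_sup_eq_top {G : Type*} [Group G] {N K X : Subgroup G}
    [N.Normal] (hKX : K ≤ X) (hinf : N ⊓ X ≤ K) (hsup : N ⊔ K = ⊤) : X ≤ K := by
  intro x hx
  obtain ⟨a, ha, k, hk, rfl⟩ :=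
    Subgroup.mem_sup_of_normal_left.1 (hsup ▸ Subgroup.mem_top x : x ∈ N ⊔ K)
  exact K.mul_mem (hinf ⟨ha, (X.mul_mem_cancel_right (hKX hk)).1 hx⟩) hk

/-- In an interval that is a parachute over a core-free subgroup, the subgroups lying in one
canopy are core-free provided another canopy has more than two elements. -/
theorem Parachute.normalCore_eq_bot {ι : Type*} {L : ι → Type*} [∀ i, Lattice (L i)]
    [∀ i, BoundedOrder (L i)] {G : Type*} [Group G] {H : Subgroup G}
    (hH : H.normalCore = ⊥) (φ : Parachute L ≃o Set.Icc H (⊤ : Subgroup G))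
    {i j : ι} (hij : i ≠ j) {x : L j} (hx : ⊥ < x) (hx' : x < ⊤)
    {Y : Subgroup G} (hY : Y ≠ ⊤) (hi : (φ (Parachute.incl i ⊥)).1 ≤ Y) :
    Y.normalCore = ⊥ := by
  by_contra hN
  set N := Y.normalCore
  have hHY : H ≤ Y := (φ (Parachute.incl i ⊥)).2.1.trans hi
  let ψ : ∀ K : Subgroup G, H ≤ K → Parachute L := fun K hK => φ.symm ⟨K, hK, le_top⟩
  have ψ_mono : ∀ {A B : Subgroup G} (hA : H ≤ A) (hB : H ≤ B), A ≤ B → ψ A hA ≤ ψ B hB :=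
    fun hA hB h => φ.symm.monotone h
  have ψ_top : ∀ {A : Subgroup G} (hA : H ≤ A), (ψ A hA).1 = ⊤ → A = ⊤ := fun {A} hA h => by
    have : φ.symm ⟨⊤, le_top, le_rfl⟩ ≤ ψ A hA := by
      rw [← Subtype.coe_le_coe, h]
      exact le_top
    exact top_le_iff.1 (φ.symm.le_iff_le.1 this)
  have ψ_bot : ∀ {A : Subgroup G} (hA : H ≤ A), (∀ k, (ψ A hA).1 k = ⊥) → A ≤ H :=
    fun {A} hA h => by
      have : ψ A hA ≤ φ.symm ⟨H, le_rfl, le_top⟩ := fun k => (h k).trans_le bot_le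
      exact φ.symm.le_iff_le.1 this
  have ψ_incl : ∀ {A : Subgroup G} (hA : H ≤ A) {k : ι} {z : L k},
      (φ (Parachute.incl k z)).1 ≤ A → (ψ A hA).1 k ≠ ⊥ := fun {A} hA {k z} h => by
    apply Parachute.val_ne_bot_of_incl_le (x := z)
    exact (φ.le_symm_apply (y := ⟨A, hA, le_top⟩)).2 h
  have ne_bot_mono : ∀ {p q : Parachute L} {k : ι}, p ≤ q → p.1 k ≠ ⊥ → q.1 k ≠ ⊥ :=
    fun {p q k} h hp hq => hp (le_bot_iff.1 (hq ▸ h k))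
  have hZY : N ⊔ H ≤ Y := sup_le Y.normalCore_le hHY
  have hYi := ψ_incl hHY hi
  have hYk : ∀ k, (ψ Y hHY).1 k ≠ ⊥ → k = i := fun k hk => by
    by_contra hki
    exact hY (ψ_top hHY (Parachute.eq_top_of_ne_bot hki hk hYi))
  have hZi : (ψ (N ⊔ H) le_sup_right).1 i ≠ ⊥ := by
    intro h
    apply hN
    have hNH : N ⊔ H ≤ H := ψ_bot le_sup_right fun k => by
      by_contra hk
      have hki := hYk k (ne_bot_mono (ψ_mono le_sup_right hHY hZY) hk)
      exact hk (hki ▸ h)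
    rw [eq_bot_iff, ← hH, Subgroup.normal_le_normalCore]
    exact le_sup_left.trans hNH
  let K : Subgroup G := (φ (Parachute.incl j ⊥)).1
  let X : Subgroup G := (φ (Parachute.incl j x)).1
  have hHK : H ≤ K := (φ (Parachute.incl j ⊥)).2.1
  have hHX : H ≤ X := (φ (Parachute.incl j x)).2.1
  have hKX : K ≤ X := φ.monotone ((Parachute.incl j).monotone hx.le)
  have hψX : ψ X hHX = Parachute.incl j x := φ.symm_apply_apply _
  have hsup : N ⊔ K = ⊤ := by
    have hHNK : H ≤ N ⊔ K := hHK.trans le_sup_right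
    apply ψ_top hHNK
    exact Parachute.eq_top_of_ne_bot hij
      (ne_bot_mono (ψ_mono le_sup_right hHNK (sup_le_sup_left hHK N)) hZi)
      (ψ_incl hHNK le_sup_right)
  have hinf : N ⊓ X ≤ K := by
    have : (N ⊓ X) ⊔ H ≤ H := ψ_bot le_sup_right fun k => by
      by_contra hk
      obtain rfl := hYk k (ne_bot_mono
        (ψ_mono le_sup_right hHY ((sup_le_sup_right inf_le_left H).trans hZY)) hk)
      refine ne_bot_mono (ψ_mono le_sup_right hHX (sup_le inf_le_right hHX)) hk ?_
      rw [hψX]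
      exact Parachute.incl_val_of_ne hx'.ne hij
    exact le_sup_left.trans (this.trans hHK)
  have hXK : X ≤ K := Subgroup.le_of_inf_le_of_sup_eq_top hKX hinf hsup
  exact hx.not_ge ((Parachute.incl j).le_iff_le.1 (φ.le_iff_le.1 hXK))

theorem exists_bot_lt_lt_top {α : Type*} [PartialOrder α] [BoundedOrder α]
    (h : 2 < Nat.card α) : ∃ x : α, ⊥ < x ∧ x < ⊤ := by
  by_contra! hx
  have : (Set.univ : Set α) ⊆ {⊥, ⊤} := fun x _ => by
    by_cases hb : x = ⊥
    · exact Or.inl hb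
    · exact Or.inr (not_lt_top_iff.1 (hx x (bot_lt_iff_ne_bot.2 hb)))
  have hcard := (Set.ncard_le_ncard this).trans (Set.ncard_insert_le _ _)
  rw [Set.ncard_univ, Set.ncard_singleton] at hcard
  exact absurd hcard h.not_ge

/-- (Parachute construction.) If every finite lattice is group
representable, then for every family `L₁, …, Lₙ` (`n ≥ 2`) of finite nonempty
lattices, at least two of which have more than two elements, there is a single
finite group `G` and subgroups `H₁, …, Hₙ` with `Lᵢ ≃o ⟦Hᵢ,G⟧`, such that
every proper subgroup of `G` containing some `Hᵢ` is core-free in `G`. -/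
theorem stmt_8
    (hrep : ∀ (L : Type) [Lattice L] [Finite L] [Nonempty L],
        ∃ (G : Type) (_ : Group G) (_ : Finite G) (H : Subgroup G),
          Nonempty (L ≃o Set.Icc H (⊤ : Subgroup G)))
    (n : ℕ) (hn : 2 ≤ n)
    (L : Fin n → Type) [∀ i, Lattice (L i)] [∀ i, Finite (L i)]
    [∀ i, Nonempty (L i)]
    (hbig : ∃ i j : Fin n, i ≠ j ∧ 2 < Nat.card (L i) ∧ 2 < Nat.card (L j)) :
    ∃ (G : Type) (_ : Group G) (_ : Finite G) (H : Fin n → Subgroup G),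
      (∀ i, Nonempty (L i ≃o Set.Icc (H i) (⊤ : Subgroup G))) ∧
      (∀ Y : Subgroup G, Y ≠ ⊤ → (∃ i, H i ≤ Y) → Y.normalCore = ⊥) := by
  classical
  have hbdd : ∀ i, Nonempty (BoundedOrder (L i)) := fun i =>
    let _ := Fintype.ofFinite (L i)
    ⟨Fintype.toBoundedOrder (L i)⟩
  let _ : ∀ i, BoundedOrder (L i) := fun i => (hbdd i).some
  have : ∀ i, Finite (WithBot (L i)) := fun i => inferInstanceAs (Finite (Option (L i)))
  have : Nonempty (Parachute L) := ⟨⟨⊤, Or.inl rfl⟩⟩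
  obtain ⟨G₀, _, _, H₀, ⟨φ₀⟩⟩ := hrep (Parachute L)
  obtain ⟨G, _, _, H, hH, ⟨θ⟩⟩ := H₀.exists_normalCore_eq_bot_orderIso
  let φ := φ₀.trans θ
  refine ⟨G, inferInstance, inferInstance, fun i => (φ (Parachute.incl i ⊥)).1,
    fun i => ⟨?_⟩, ?_⟩
  · let f : L i ↪o Set.Icc (φ (Parachute.incl i ⊥)).1 (⊤ : Subgroup G) :=
      OrderEmbedding.ofMapLEIff
        (fun x => ⟨(φ (Parachute.incl i x)).1,
          φ.monotone ((Parachute.incl (L := L) i).monotone bot_le), le_top⟩)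
        (fun _ _ => φ.le_iff_le.trans (Parachute.incl (L := L) i).le_iff_le)
    refine RelIso.ofSurjective f fun K => ?_
    let K' : Set.Icc H (⊤ : Subgroup G) :=
      ⟨K.1, (φ (Parachute.incl i ⊥)).2.1.trans K.2.1, le_top⟩
    have hle : Parachute.incl i ⊥ ≤ φ.symm K' := φ.le_symm_apply.2 K.2.1
    obtain ⟨x, hx⟩ := Parachute.exists_incl_eq (Parachute.val_ne_bot_of_incl_le hle)
    refine ⟨x, Subtype.ext ?_⟩
    change (φ (Parachute.incl i x)).1 = K.1
    rw [hx, φ.apply_symm_apply]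
  · rintro Y hY ⟨i, hi⟩
    obtain ⟨j, hij, hj⟩ : ∃ j, i ≠ j ∧ 2 < Nat.card (L j) := by
      obtain ⟨a, b, hab, ha, hb⟩ := hbig
      by_cases hia : i = a
      · exact ⟨b, hia ▸ hab, hb⟩
      · exact ⟨a, hia, ha⟩
    obtain ⟨x, hx, hx'⟩ := exists_bot_lt_lt_top hj
    exact Parachute.normalCore_eq_bot hH φ hij hx hx' hY hi
end

section
/- Let G be a finite group and H a subgroup of G such that every proper subgroup Y of G with H ≤ Y is core-free in G, and suppose there exists a subgroup K with H < K < ⊤. Then every nontrivial normal subgroup N of G has trivial centralizer in G: the centralizer of (the underlying set of) N in G equals the trivial subgroup ⊥. -/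
/-- If every proper overgroup of `H` is core-free, then `H` supplements every nontrivial
normal subgroup. -/
theorem sup_eq_top_of_forall_normalCore_eq_bot {G : Type*} [Group G] {H : Subgroup G}
    (hcf : ∀ Y : Subgroup G, Y ≠ ⊤ → H ≤ Y → Y.normalCore = ⊥)
    {M : Subgroup G} [M.Normal] (hM : M ≠ ⊥) : H ⊔ M = ⊤ := by
  by_contra h
  have hle : M ≤ (H ⊔ M).normalCore := Subgroup.normal_le_normalCore.mpr le_sup_right
  rw [hcf _ h le_sup_left] at hle
  exact hM (le_bot_iff.mp hle)

/-- If `K` supplements the centralizer of a normal subgroup `N`, then `N ⊓ K` is normal. -/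
theorem inf_normal_of_sup_centralizer_eq_top {G : Type*} [Group G] {K N : Subgroup G}
    [hN : N.Normal] (h : K ⊔ Subgroup.centralizer (N : Set G) = ⊤) : (N ⊓ K).Normal := by
  refine ⟨fun n hn g => ?_⟩
  have hg : g ∈ K ⊔ Subgroup.centralizer (N : Set G) := h ▸ Subgroup.mem_top g
  obtain ⟨k, hk, c, hc, rfl⟩ := Subgroup.mem_sup_of_normal_right.mp hg
  have hcn : n * c = c * n := Subgroup.mem_centralizer_iff.mp hc n hn.1
  have hconj : k * c * n * (k * c)⁻¹ = k * n * k⁻¹ := by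
    rw [mul_assoc k c n, ← hcn]
    group
  rw [hconj]
  exact ⟨hN.conj_mem n hn.1 k, K.mul_mem (K.mul_mem hk hn.2) (K.inv_mem hk)⟩

/-- If every proper subgroup of `G` containing `H` is core-free
and there is some `K` strictly between `H` and `G`, then every nontrivial
normal subgroup of `G` has trivial centralizer. -/
theorem stmt_11 {G : Type} [Group G] [Finite G] (H : Subgroup G)
    (hcf : ∀ Y : Subgroup G, Y ≠ ⊤ → H ≤ Y → Y.normalCore = ⊥)
    (K : Subgroup G) (hHK : H < K) (hKtop : K < ⊤)
    (N : Subgroup G) [N.Normal] (hN : N ≠ ⊥) :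
    Subgroup.centralizer (N : Set G) = ⊥ := by
  by_contra hC
  have hKC : K ⊔ Subgroup.centralizer (N : Set G) = ⊤ :=
    top_le_iff.mp ((sup_eq_top_of_forall_normalCore_eq_bot hcf hC).ge.trans
      (sup_le_sup_right hHK.le _))
  have := inf_normal_of_sup_centralizer_eq_top hKC
  have hNK : N ⊓ K ≤ ⊥ :=
    hcf K hKtop.ne hHK.le ▸ Subgroup.normal_le_normalCore.mpr inf_le_right
  refine hHK.not_ge fun k hk => ?_
  have hkHN : k ∈ H ⊔ N :=
    sup_eq_top_of_forall_normalCore_eq_bot hcf hN ▸ Subgroup.mem_top k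
  obtain ⟨x, hx, n, hn, rfl⟩ := Subgroup.mem_sup_of_normal_right.mp hkHN
  have hnK : n ∈ K := (K.mul_mem_cancel_left (hHK.le hx)).mp hk
  have hn1 : n = 1 := Subgroup.mem_bot.mp (hNK ⟨hn, hnK⟩)
  rwa [hn1, mul_one]
end

section
/- Let G be a finite group and H a subgroup of G such that every proper subgroup Y of G with H ≤ Y is core-free in G, and suppose there exists a subgroup K with H < K < ⊤. Then G is subdirectly irreducible, i.e., G has a unique minimal normal subgroup: there exists a nontrivial normal subgroup M of G such that M ≤ N for every nontrivial normal subgroup N of G. -/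
/-- If `M` and `N` are disjoint normal subgroups and `K` supplements `N`, then `K ⊓ M` is normal. -/
theorem Subgroup.inf_normal_of_disjoint_of_sup_eq_top {G : Type*} [Group G]
    {K M N : Subgroup G} (hM : M.Normal) (hN : N.Normal) (hdis : Disjoint M N)
    (hKN : K ⊔ N = ⊤) : (K ⊓ M).Normal := by
  refine ⟨fun x hx g => ?_⟩
  have hg : g ∈ K ⊔ N := hKN ▸ Subgroup.mem_top g
  obtain ⟨k, hk, n, hn, rfl⟩ := Subgroup.mem_sup_of_normal_right.1 hg
  have hxn : Commute x n := Subgroup.commute_of_normal_of_disjoint M N hM hN hdis x n hx.2 hn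
  have hconj : k * n * x * (k * n)⁻¹ = k * x * k⁻¹ := by
    rw [mul_assoc k n x, ← hxn.eq]
    group
  rw [hconj]
  exact ⟨K.mul_mem (K.mul_mem hk hx.1) (K.inv_mem hk), hM.conj_mem x hx.2 k⟩

/-- A normal subgroup contained in a core-free subgroup is trivial. -/
theorem Subgroup.eq_bot_of_le_of_normalCore_eq_bot {G : Type*} [Group G] {N Y : Subgroup G}
    (hN : N.Normal) (hNY : N ≤ Y) (hY : Y.normalCore = ⊥) : N = ⊥ :=
  le_bot_iff.1 (hY ▸ Subgroup.normal_le_normalCore.2 hNY)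

/-- If every proper subgroup of `G` containing `H` is core-free
and there is some `K` strictly between `H` and `G`, then `G` is subdirectly
irreducible: it has a unique minimal normal subgroup. -/
theorem stmt_12 {G : Type} [Group G] [Finite G] (H : Subgroup G)
    (hcf : ∀ Y : Subgroup G, Y ≠ ⊤ → H ≤ Y → Y.normalCore = ⊥)
    (K : Subgroup G) (hHK : H < K) (hKtop : K < ⊤) :
    ∃ M : Subgroup G, M.Normal ∧ M ≠ ⊥ ∧
      ∀ N : Subgroup G, N.Normal → N ≠ ⊥ → M ≤ N := by
  have hsup : ∀ N : Subgroup G, N.Normal → N ≠ ⊥ → ∀ Y : Subgroup G, H ≤ Y → Y ⊔ N = ⊤ := by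
    intro N hN hN0 Y hY
    by_contra htop
    exact hN0 (Subgroup.eq_bot_of_le_of_normalCore_eq_bot hN le_sup_right
      (hcf _ htop (hY.trans le_sup_left)))
  have htop_ne : (⊤ : Subgroup G) ≠ ⊥ := (bot_le.trans_lt hKtop).ne'
  obtain ⟨M, ⟨hM, hM0⟩, hmin⟩ := (Set.toFinite {N : Subgroup G | N.Normal ∧ N ≠ ⊥}).exists_minimal
    ⟨⊤, inferInstance, htop_ne⟩
  refine ⟨M, hM, hM0, fun N hN hN0 => ?_⟩
  by_cases hMN : M ⊓ N = ⊥
  · have hKM : K ⊓ M = ⊥ := Subgroup.eq_bot_of_le_of_normalCore_eq_bot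
      (Subgroup.inf_normal_of_disjoint_of_sup_eq_top hM hN (disjoint_iff.2 hMN)
        (hsup N hN hN0 K hHK.le)) inf_le_left (hcf K hKtop.ne hHK.le)
    refine absurd (fun x hx => ?_) hHK.not_ge
    have hxHM : x ∈ H ⊔ M := hsup M hM hM0 H le_rfl ▸ Subgroup.mem_top x
    obtain ⟨h, hh, m, hm, rfl⟩ := Subgroup.mem_sup_of_normal_right.1 hxHM
    have hmK : m ∈ K ⊓ M := ⟨(K.mul_mem_cancel_left (hHK.le hh)).1 hx, hm⟩
    rw [hKM, Subgroup.mem_bot] at hmK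
    rwa [hmK, mul_one]
  · exact (hmin ⟨Subgroup.normal_inf_normal M N, hMN⟩ inf_le_left).trans inf_le_right
end

section
/- Let G be a finite group and H a subgroup of G such that every proper subgroup Y of G with H ≤ Y is core-free in G, and suppose there exists a subgroup K with H < K < ⊤. Then G is not solvable. -/
/-- A nontrivial solvable group has a nontrivial abelian normal subgroup. -/
theorem exists_normal_abelian_ne_bot (G : Type*) [Group G] [Nontrivial G] [Group.IsSolvable G] :
    ∃ A : Subgroup G, A.Normal ∧ A ≠ ⊥ ∧ ∀ x ∈ A, ∀ y ∈ A, x * y = y * x := by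
  classical
  have hsol : ∃ n, derivedSeries G n = ⊥ := Group.IsSolvable.solvable
  obtain ⟨m, hm⟩ : ∃ m, Nat.find hsol = m + 1 := by
    refine Nat.exists_eq_succ_of_ne_zero fun h0 => ?_
    have hbot := Nat.find_spec hsol
    rw [h0, derivedSeries_zero] at hbot
    exact top_ne_bot hbot
  refine ⟨derivedSeries G m, inferInstance, Nat.find_min hsol (by omega), fun x hx y hy => ?_⟩
  have hbot := Nat.find_spec hsol
  rw [hm, derivedSeries_succ] at hbot
  have hmem := Subgroup.commutator_mem_commutator hx hy
  rw [hbot, Subgroup.mem_bot] at hmem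
  exact commutatorElement_eq_one_iff_mul_comm.mp hmem

/-- If `H` and a normal abelian subgroup `A` generate the group, then `K ⊓ A` is normal for every
subgroup `K` containing `H`. -/
theorem Subgroup.inf_normal_of_sup_eq_top {G : Type*} [Group G] {H K A : Subgroup G} [A.Normal]
    (hcomm : ∀ x ∈ A, ∀ y ∈ A, x * y = y * x) (hHK : H ≤ K) (hsup : H ⊔ A = ⊤) :
    (K ⊓ A).Normal := by
  refine ⟨fun n hn g => ?_⟩
  obtain ⟨hnK, hnA⟩ := Subgroup.mem_inf.mp hn
  refine Subgroup.mem_inf.mpr ⟨?_, Subgroup.Normal.conj_mem inferInstance n hnA g⟩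
  obtain ⟨h, hh, a, ha, rfl⟩ :=
    Subgroup.mem_sup_of_normal_right.mp (hsup ▸ Subgroup.mem_top g : g ∈ H ⊔ A)
  have hconj : h * a * n * (h * a)⁻¹ = h * n * h⁻¹ := by
    rw [mul_assoc h a n, hcomm a ha n hnA]
    group
  rw [hconj]
  exact K.mul_mem (K.mul_mem (hHK hh) hnK) (K.inv_mem (hHK hh))

/-- If every proper subgroup of `G` containing `H` is core-free
and there is some `K` strictly between `H` and `G`, then `G` is not solvable. -/
theorem stmt_13 {G : Type} [Group G] [Finite G] (H : Subgroup G)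
    (hcf : ∀ Y : Subgroup G, Y ≠ ⊤ → H ≤ Y → Y.normalCore = ⊥)
    (K : Subgroup G) (hHK : H < K) (hKtop : K < ⊤) :
    ¬ IsSolvable G := by
  intro hsolv
  have : Group.IsSolvable G := hsolv
  have : Nontrivial G := Subgroup.nontrivial_iff.mp ⟨H, K, hHK.ne⟩
  obtain ⟨A, hA, hAbot, hcomm⟩ := exists_normal_abelian_ne_bot G
  have hsup : H ⊔ A = ⊤ := by
    by_contra hne
    have hle : A ≤ (H ⊔ A).normalCore := Subgroup.normal_le_normalCore.mpr le_sup_right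
    rw [hcf _ hne le_sup_left] at hle
    exact hAbot (le_bot_iff.mp hle)
  have hKA : (K ⊓ A).Normal := Subgroup.inf_normal_of_sup_eq_top hcomm hHK.le hsup
  have hle : K ⊓ A ≤ K.normalCore := Subgroup.normal_le_normalCore.mpr inf_le_left
  rw [hcf K hKtop.ne hHK.le] at hle
  refine hHK.not_ge fun k hk => ?_
  obtain ⟨h, hh, a, ha, rfl⟩ :=
    Subgroup.mem_sup_of_normal_right.mp (hsup ▸ Subgroup.mem_top k : k ∈ H ⊔ A)
  have ha1 : a = 1 :=
    Subgroup.mem_bot.mp (hle ⟨(K.mul_mem_cancel_left (hHK.le hh)).mp hk, ha⟩)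
  simpa [ha1] using hh
end

section
/- Let G be a finite group and H a subgroup of G such that every proper subgroup Y of G with H ≤ Y is core-free in G, and suppose there exists a subgroup K with H < K < ⊤. Then every nontrivial normal subgroup N of G is nonabelian: there exist elements a, b ∈ N with a * b ≠ b * a. -/
/-- If `N` is an abelian normal subgroup with `K ⊔ N = ⊤`, then `K ⊓ N` is normal. -/
theorem Subgroup.normal_inf_of_sup_eq_top {G : Type*} [Group G] {K N : Subgroup G}
    (hN : N.Normal) (hcomm : ∀ a ∈ N, ∀ b ∈ N, a * b = b * a) (hKN : K ⊔ N = ⊤) :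
    (K ⊓ N).Normal := by
  refine ⟨fun n hn g => ?_⟩
  obtain ⟨k, hk, m, hm, rfl⟩ := Subgroup.mem_sup_of_normal_right.mp (hKN ▸ Subgroup.mem_top g)
  have hconj : k * m * n * (k * m)⁻¹ = k * n * k⁻¹ := by
    rw [mul_assoc k m n, hcomm m hm n hn.2]
    group
  rw [hconj]
  exact ⟨K.mul_mem (K.mul_mem hk hn.1) (K.inv_mem hk), hN.conj_mem n hn.2 k⟩

/-- If every proper subgroup of `G` containing `H` is core-free
and there is some `K` strictly between `H` and `G`, then every nontrivial
normal subgroup of `G` is nonabelian. -/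
theorem stmt_14 {G : Type} [Group G] [Finite G] (H : Subgroup G)
    (hcf : ∀ Y : Subgroup G, Y ≠ ⊤ → H ≤ Y → Y.normalCore = ⊥)
    (K : Subgroup G) (hHK : H < K) (hKtop : K < ⊤)
    (N : Subgroup G) (hNnormal : N.Normal) (hN : N ≠ ⊥) :
    ∃ a b : G, a ∈ N ∧ b ∈ N ∧ a * b ≠ b * a := by
  by_contra! hcomm
  have hHN : H ⊔ N = ⊤ := by
    by_contra hne
    have hle : N ≤ (H ⊔ N).normalCore := Subgroup.normal_le_normalCore.mpr le_sup_right
    exact hN (le_bot_iff.mp (hcf _ hne le_sup_left ▸ hle))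
  have hKN : K ⊔ N = ⊤ := top_le_iff.mp (hHN ▸ sup_le_sup_right hHK.le N)
  have hnormal : (K ⊓ N).Normal :=
    Subgroup.normal_inf_of_sup_eq_top hNnormal (fun a ha b hb => hcomm a b ha hb) hKN
  have hinf : K ⊓ N = ⊥ := by
    have hle : K ⊓ N ≤ K.normalCore := Subgroup.normal_le_normalCore.mpr inf_le_left
    exact le_bot_iff.mp (hcf K hKtop.ne hHK.le ▸ hle)
  refine hHK.not_ge fun k hk => ?_
  obtain ⟨h, hh, n, hn, rfl⟩ := Subgroup.mem_sup_of_normal_right.mp (hHN ▸ Subgroup.mem_top k)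
  have hnK : n ∈ K := (K.mul_mem_cancel_left (hHK.le hh)).mp hk
  have hn1 : n = 1 := Subgroup.mem_bot.mp (hinf ▸ (⟨hnK, hn⟩ : n ∈ K ⊓ N))
  simpa [hn1] using hh
end

section
/- Let G be a finite group and H a core-free subgroup of G whose index |G : H| is greater than 2, and let S be a finite nonabelian simple group. Let G act on the coset space G⧸H by left multiplication, and let α : G →* MulAut ((G⧸H) → S) be the induced action permuting coordinates of the direct power, i.e., (α g f)(x) = f(g⁻¹ • x) for f : (G⧸H) → S and x ∈ G⧸H. Form the semidirect product U = ((G⧸H) → S) ⋊[α] G, and let T be the subgroup of U consisting of all pairs (f, g) in which f is a constant function. Then T is core-free in U: the normal core of T in U is trivial. -/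
/-- The action of `G` on the direct power `(G ⧸ H) → S`, permuting coordinates
according to the left-multiplication action of `G` on the coset space `G ⧸ H`:
`(α g f) x = f (g⁻¹ • x)`. -/
def cosetPermAction (G : Type) [Group G] (H : Subgroup G) (S : Type) [Group S] :
    G →* MulAut ((G ⧸ H) → S) where
  toFun g :=
    { toFun := fun f x => f (g⁻¹ • x)
      invFun := fun f x => f (g • x)
      left_inv := fun f => by funext x; simp
      right_inv := fun f => by funext x; simp
      map_mul' := fun f₁ f₂ => rfl }
  map_one' := by
    refine MulEquiv.ext fun f => funext fun x => ?_
    simp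
  map_mul' g₁ g₂ := by
    refine MulEquiv.ext fun f => funext fun x => ?_
    simp [mul_smul]

/-- The subgroup `T` of the semidirect product
`U = ((G ⧸ H) → S) ⋊[cosetPermAction G H S] G` consisting of all pairs `(f, g)`
in which `f` is a constant function. -/
def constPairs (G : Type) [Group G] (H : Subgroup G) (S : Type) [Group S] :
    Subgroup (((G ⧸ H) → S) ⋊[cosetPermAction G H S] G) where
  carrier := {u | ∃ s : S, u.left = Function.const (G ⧸ H) s}
  one_mem' := ⟨1, rfl⟩
  mul_mem' := by
    rintro a b ⟨s, hs⟩ ⟨t, ht⟩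
    refine ⟨s * t, ?_⟩
    have hab : (a * b).left = a.left * (cosetPermAction G H S) a.right b.left := rfl
    rw [hab, hs, ht]
    rfl
  inv_mem' := by
    rintro a ⟨s, hs⟩
    refine ⟨s⁻¹, ?_⟩
    have ha : (a⁻¹).left = (cosetPermAction G H S) a.right⁻¹ a.left⁻¹ := rfl
    rw [ha, hs]
    rfl

theorem cosetPermAction_apply {G : Type} [Group G] {H : Subgroup G} {S : Type} [Group S]
    (g : G) (f : (G ⧸ H) → S) (x : G ⧸ H) :
    cosetPermAction G H S g f x = f (g⁻¹ • x) :=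
  rfl

/-- Conjugating an element of the normal core of `constPairs G H S` by `(f, 1)` yields
an element whose first coordinate is again constant. -/
theorem constPairs_normalCore_conj_eq {G : Type} [Group G] {H : Subgroup G}
    {S : Type} [Group S] {u : ((G ⧸ H) → S) ⋊[cosetPermAction G H S] G}
    (hu : u ∈ (constPairs G H S).normalCore) (f : (G ⧸ H) → S) (x y : G ⧸ H) :
    f x * u.left x * (f (u.right⁻¹ • x))⁻¹ = f y * u.left y * (f (u.right⁻¹ • y))⁻¹ := by
  obtain ⟨c, hc⟩ := hu (SemidirectProduct.inl f)
  have key : ∀ z, f z * u.left z * (f (u.right⁻¹ • z))⁻¹ = c := fun z => by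
    simpa [cosetPermAction_apply] using congrFun hc z
  rw [key, key]

/-- An element acting trivially on `G ⧸ H` lies in the normal core of `H`. -/
theorem mem_normalCore_of_forall_smul_eq {G : Type} [Group G] {H : Subgroup G} {g : G}
    (hg : ∀ x : G ⧸ H, g • x = x) : g ∈ H.normalCore := by
  rw [Subgroup.normalCore_eq_ker, MonoidHom.mem_ker]
  exact Equiv.ext hg

/-- The center of a nonabelian simple group is trivial. -/
theorem IsSimpleGroup.center_eq_bot_of_exists_not_commute {S : Type} [Group S]
    (hS : IsSimpleGroup S) (hna : ∃ a b : S, a * b ≠ b * a) : Subgroup.center S = ⊥ := by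
  refine (hS.eq_bot_or_eq_top_of_normal _ inferInstance).resolve_right fun htop => ?_
  obtain ⟨a, b, hab⟩ := hna
  have hb : b ∈ Subgroup.center S := htop ▸ Subgroup.mem_top b
  exact hab (Subgroup.mem_center_iff.1 hb a)

/-- (Kurzweil's construction.) If `H` is a core-free subgroup of
the finite group `G` with `|G : H| > 2` and `S` is a finite nonabelian simple
group, then the subgroup of constant-first-coordinate pairs is core-free in
the wreath-product-like semidirect product
`((G ⧸ H) → S) ⋊[cosetPermAction G H S] G`. -/
theorem stmt_16 (G : Type) [Group G] [Finite G] (H : Subgroup G)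
    (hcf : H.normalCore = ⊥) (hidx : 2 < H.index)
    (S : Type) [Group S] [Finite S] (hS : IsSimpleGroup S)
    (hna : ∃ a b : S, a * b ≠ b * a) :
    (constPairs G H S).normalCore = ⊥ := by
  classical
  rw [Subgroup.eq_bot_iff_forall]
  intro u hu
  obtain ⟨s, hs⟩ := Subgroup.normalCore_le _ hu
  have conj := constPairs_normalCore_conj_eq hu
  simp only [hs, Function.const_apply] at conj
  have : Fintype (G ⧸ H) := Fintype.ofFinite _
  have hcard : 2 < Fintype.card (G ⧸ H) := by
    rwa [← Nat.card_eq_fintype_card]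
  have hfix : ∀ x : G ⧸ H, u.right • x = x := by
    intro x
    by_contra hx
    obtain ⟨a, ha⟩ := exists_ne (1 : S)
    obtain ⟨y, hyx, hy⟩ : ∃ y : G ⧸ H, y ≠ x ∧ y ≠ u.right • x := by
      obtain ⟨y, -, hy⟩ := Finset.exists_mem_notMem_of_card_lt_card
        (s := {x, u.right • x}) (t := Finset.univ) (Finset.card_le_two.trans_lt hcard)
      exact ⟨y, by simpa using hy⟩
    have hx' : u.right⁻¹ • x ≠ x := fun h => hx (inv_smul_eq_iff.1 h).symm
    have hy' : u.right⁻¹ • y ≠ x := fun h => hy (inv_smul_eq_iff.1 h)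
    have h := conj (Pi.mulSingle x a) x y
    simp [Pi.mulSingle_eq_of_ne, hx', hy', hyx] at h
    exact ha h
  have hright : u.right = 1 := by
    rw [← Subgroup.mem_bot, ← hcf]
    exact mem_normalCore_of_forall_smul_eq hfix
  have hcenter : s ∈ Subgroup.center S := by
    rw [Subgroup.mem_center_iff]
    intro a
    have : Nontrivial (G ⧸ H) := Fintype.one_lt_card_iff_nontrivial.1 (by omega)
    let x : G ⧸ H := (1 : G)
    obtain ⟨y, hy⟩ := exists_ne x
    have h := conj (Pi.mulSingle x a) x y
    simpa [hright, Pi.mulSingle_eq_of_ne hy, mul_inv_eq_iff_eq_mul] using h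
  rw [hS.center_eq_bot_of_exists_not_commute hna, Subgroup.mem_bot] at hcenter
  refine SemidirectProduct.ext ?_ hright
  rw [hs, hcenter]
  rfl
end
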